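/- arXiv:2111.07111 — 2 statements merged into one kernel-verified Lean document; each statement's English description precedes it below -/
import Mathlib

section
/- There is a constant C > 0, independent of α and F^z, with the following property. Let α ≥ 0, let F^z be a complex-valued continuously differentiable function on [0,1], and let ψ be a complex-valued function, four times continuously differentiable on (0,1], such that ψ, ψ', 𝓛ψ and (d/dr)(r·𝓛ψ) extend continuously to [0,1], ψ satisfies (𝓛²ψ)(r) = (F^z)'(r) for all 0 < r < 1, and the boundary conditions ψ(0) = ψ(1) = (𝓛ψ)(0) = 0 and (𝓛ψ)(1) = −α·ψ'(1) hold. Then ∫₀¹ |(𝓛ψ)(r)|²·r dr + α·|ψ'(1)|² ≤ C·∫₀¹ |F^z(r)|²·r dr. (Proposition 3.2, estimate (B-1)/(2-1-7-0): the zero mode of the linearized problem.) -/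
open MeasureTheory Filter

/-- One-sided derivative on `(0,1]`. -/
noncomputable def dz (g : ℝ → ℂ) : ℝ → ℂ := derivWithin g (Set.Ioc 0 1)

/-- The operator `(𝓛 g)(r) = g''(r) + (1/r) g'(r) − (1/r²) g(r)`. -/
noncomputable def Lop (g : ℝ → ℂ) : ℝ → ℂ := fun r =>
  dz (dz g) r + ((r : ℂ))⁻¹ * dz g r - (((r : ℂ)) ^ 2)⁻¹ * g r

/-- Weighted integral over `(0,1)` with values in `[0,∞]`. -/
noncomputable def wInt (h : ℝ → ℝ) : ENNReal :=
  ∫⁻ r in Set.Ioo (0 : ℝ) 1, ENNReal.ofReal (h r)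

lemma aux_ineq (r p p1 p2 w w1 w2 f f1 : ℝ) (h0 : 0 < r) (h1 : r < 1)
    (hw : w = p2 + r⁻¹ * p1 - (r ^ 2)⁻¹ * p)
    (hf : w2 + r⁻¹ * w1 - (r ^ 2)⁻¹ * w = f1) :
    r * w ^ 2 - r * f ^ 2 ≤
      ((2 * w + 2 * r * w1) * p1 + 2 * r * w * p2)
      - ((2 * (w1 - f) + 2 * r * (w2 - f1)) * p + 2 * r * (w1 - f) * p1)
      + ((2 * p1 + 2 * r * p2) * p + 2 * r * p1 * p1) + 2 * p * p1 := by
  have e1 : p2 = w - r⁻¹ * p1 + (r ^ 2)⁻¹ * p := by linarith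
  have e2 : f1 = w2 + r⁻¹ * w1 - (r ^ 2)⁻¹ * w := hf.symm
  have key : ((2 * w + 2 * r * w1) * p1 + 2 * r * w * p2)
      - ((2 * (w1 - f) + 2 * r * (w2 - f1)) * p + 2 * r * (w1 - f) * p1)
      + ((2 * p1 + 2 * r * p2) * p + 2 * r * p1 * p1) + 2 * p * p1
      = r * w ^ 2 - r * f ^ 2 + (r * (f + p1 + p / r) ^ 2 + r * (w + p) ^ 2
        + p ^ 2 * ((1 - r ^ 2) / r) + r * p1 ^ 2) := by
    rw [e1, e2]
    field_simp
    ring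
  rw [key]
  have : 0 ≤ (1 - r ^ 2) / r := div_nonneg (by nlinarith) h0.le
  have : 0 ≤ r * (f + p1 + p / r) ^ 2 + r * (w + p) ^ 2
        + p ^ 2 * ((1 - r ^ 2) / r) + r * p1 ^ 2 := by positivity
  linarith

lemma aux_deriv (p p1 w w1 f : ℝ → ℝ) (r dp dp1 dw dw1 df : ℝ)
    (hp : HasDerivAt p dp r) (hp1 : HasDerivAt p1 dp1 r) (hw : HasDerivAt w dw r)
    (hw1 : HasDerivAt w1 dw1 r) (hf : HasDerivAt f df r) :
    HasDerivAt (fun r => 2 * r * w r * p1 r - 2 * r * (w1 r - f r) * p r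
        + 2 * r * p1 r * p r + p r ^ 2)
      (((2 * w r + 2 * r * dw) * p1 r + 2 * r * w r * dp1)
      - ((2 * (w1 r - f r) + 2 * r * (dw1 - df)) * p r + 2 * r * (w1 r - f r) * dp)
      + ((2 * p1 r + 2 * r * dp1) * p r + 2 * r * p1 r * dp) + 2 * p r * dp) r := by
  have h2 : HasDerivAt (fun r : ℝ => 2 * r) 2 r := by
    simpa using (hasDerivAt_id r).const_mul 2
  have := ((((h2.mul hw).mul hp1).sub ((h2.mul (hw1.sub hf)).mul hp)).add
    ((h2.mul hp1).mul hp)).add (hp.pow 2)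
  refine this.congr_deriv ?_
  simp

/-- Real component estimate. -/
lemma aux_comp (π : ℂ →L[ℝ] ℝ) (α : ℝ) (Fz ψ : ℝ → ℂ)
    (hF : ContDiffOn ℝ 1 Fz (Set.Icc 0 1))
    (hψ : ContDiffOn ℝ 4 ψ (Set.Ioc 0 1))
    (hψ0 : Tendsto ψ (nhdsWithin (0 : ℝ) (Set.Ioc 0 1)) (nhds (0 : ℂ)))
    (hψ1 : ∃ L : ℂ, Tendsto (dz ψ) (nhdsWithin (0 : ℝ) (Set.Ioc 0 1)) (nhds L))
    (hw0 : Tendsto (Lop ψ) (nhdsWithin (0 : ℝ) (Set.Ioc 0 1)) (nhds (0 : ℂ)))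
    (hw1 : ∃ L : ℂ, Tendsto (dz (fun r => (r : ℂ) * Lop ψ r))
          (nhdsWithin (0 : ℝ) (Set.Ioc 0 1)) (nhds L))
    (heq : ∀ r ∈ Set.Ioo (0 : ℝ) 1, Lop (Lop ψ) r = dz Fz r)
    (hb : ψ 1 = 0) (hα : Lop ψ 1 = -(α : ℂ) * dz ψ 1) :
    ContinuousOn (Function.update (Lop ψ) 0 0) (Set.Icc 0 1) ∧
    ∫ r in (0:ℝ)..1, (r * (π (Function.update (Lop ψ) 0 0 r)) ^ 2 - r * (π (Fz r)) ^ 2)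
      ≤ - 2 * α * (π (dz ψ 1)) ^ 2 := by
  have hs : UniqueDiffOn ℝ (Set.Ioc (0:ℝ) 1) := uniqueDiffOn_Ioc 0 1
  have c1 : ContDiffOn ℝ 3 (dz ψ) (Set.Ioc 0 1) := hψ.derivWithin hs (by norm_num)
  have c2 : ContDiffOn ℝ 2 (dz (dz ψ)) (Set.Ioc 0 1) := c1.derivWithin hs (by norm_num)
  have hof : ContDiffOn ℝ 2 (fun r : ℝ => (r : ℂ)) (Set.Ioc 0 1) :=
    Complex.ofRealCLM.contDiff.contDiffOn
  have cw : ContDiffOn ℝ 2 (Lop ψ) (Set.Ioc 0 1) := by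
    unfold Lop
    refine (c2.add ((hof.inv ?_).mul (c1.of_le (by norm_num)))).sub
      (((hof.pow 2).inv ?_).mul (hψ.of_le (by norm_num)))
    · intro x hx
      exact_mod_cast hx.1.ne'
    · intro x hx
      exact_mod_cast (pow_pos hx.1 2).ne'
  have cw1 : ContDiffOn ℝ 1 (dz (Lop ψ)) (Set.Ioc 0 1) := cw.derivWithin hs (by norm_num)
  have hd : ∀ (g : ℝ → ℂ), DifferentiableOn ℝ g (Set.Ioc 0 1) → ∀ r ∈ Set.Ioo (0:ℝ) 1,
      HasDerivAt (fun r => π (g r)) (π (dz g r)) r := by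
    intro g hg r hr
    have h1 : HasDerivAt g (dz g r) r :=
      (hg r ⟨hr.1, hr.2.le⟩).hasDerivWithinAt.hasDerivAt (Ioc_mem_nhds hr.1 hr.2)
    exact π.hasFDerivAt.comp_hasDerivAt r h1
  -- the operator, componentwise
  have hL : ∀ (g : ℝ → ℂ) (r : ℝ), π (Lop g r)
      = π (dz (dz g) r) + r⁻¹ * π (dz g r) - (r ^ 2)⁻¹ * π (g r) := by
    intro g r
    have : Lop g r = dz (dz g) r + r⁻¹ • dz g r - (r ^ 2)⁻¹ • g r := by
      simp [Lop, Complex.real_smul]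
    rw [this, map_sub, map_add, map_smul, map_smul, smul_eq_mul, smul_eq_mul]
  -- extension by continuity at zero
  have hcu : ∀ {X : Type} [TopologicalSpace X] (g : ℝ → X) (y : X),
      ContinuousOn g (Set.Ioc 0 1) →
      Tendsto g (nhdsWithin (0 : ℝ) (Set.Ioc 0 1)) (nhds y) →
      ContinuousOn (Function.update g 0 y) (Set.Icc 0 1) := by
    intro X _ g y hg hy
    rw [continuousOn_update_iff]
    have : Set.Icc (0:ℝ) 1 \ {0} = Set.Ioc 0 1 := Set.Icc_sdiff_left
    rw [this]
    exact ⟨hg, fun _ => hy⟩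
  have cwt := hcu (Lop ψ) 0 cw.continuousOn hw0
  refine ⟨cwt, ?_⟩
  set E : ℝ → ℝ := fun r => 2 * r * π (Lop ψ r) * π (dz ψ r)
    - 2 * r * (π (dz (Lop ψ) r) - π (Fz r)) * π (ψ r)
    + 2 * r * π (dz ψ r) * π (ψ r) + π (ψ r) ^ 2 with hE
  have cE : ContinuousOn E (Set.Ioc 0 1) := by
    have a1 := π.continuous.comp_continuousOn hψ.continuousOn
    have a2 := π.continuous.comp_continuousOn c1.continuousOn
    have a3 := π.continuous.comp_continuousOn cw.continuousOn
    have a4 := π.continuous.comp_continuousOn cw1.continuousOn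
    have a5 := π.continuous.comp_continuousOn (hF.continuousOn.mono Set.Ioc_subset_Icc_self)
    have a6 : ContinuousOn (fun r : ℝ => 2 * r) (Set.Ioc 0 1) := by fun_prop
    exact ((((a6.mul a3).mul a2).sub ((a6.mul (a4.sub a5)).mul a1)).add
      ((a6.mul a2).mul a1)).add (a1.pow 2)
  have tE : Tendsto E (nhdsWithin (0 : ℝ) (Set.Ioc 0 1)) (nhds 0) := by
    obtain ⟨L1, hL1⟩ := hψ1
    obtain ⟨L2, hL2⟩ := hw1
    have tr : Tendsto (fun r : ℝ => r) (nhdsWithin (0 : ℝ) (Set.Ioc 0 1)) (nhds 0) :=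
      tendsto_id.mono_left nhdsWithin_le_nhds
    have t1 := (π.continuous.tendsto _).comp hψ0
    have t2 := (π.continuous.tendsto _).comp hL1
    have t3 := (π.continuous.tendsto _).comp hw0
    have t4 : Tendsto (fun r : ℝ => r * π (dz (Lop ψ) r))
        (nhdsWithin (0 : ℝ) (Set.Ioc 0 1)) (nhds (π (L2 - 0))) := by
      have := (π.continuous.tendsto _).comp (hL2.sub hw0)
      refine this.congr' ?_
      filter_upwards [self_mem_nhdsWithin] with r hr
      have hd1 := (cw.differentiableOn (by norm_num) r hr).hasDerivWithinAt
      have hd2 : HasDerivWithinAt (fun r : ℝ => (r : ℂ)) 1 (Set.Ioc 0 1) r :=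
        Complex.ofRealCLM.hasDerivAt.hasDerivWithinAt
      have hd3 := (hd2.mul hd1).derivWithin (hs r hr)
      have hd4 : dz (fun r => (r : ℂ) * Lop ψ r) r = 1 * Lop ψ r + r * dz (Lop ψ) r := hd3
      have : (dz (fun r => (r : ℂ) * Lop ψ r) r - Lop ψ r) = r • dz (Lop ψ) r := by
        rw [hd4, Complex.real_smul]; ring
      simp only [Function.comp_apply, this, map_smul, smul_eq_mul]
    have t5 : Tendsto (fun r : ℝ => π (Fz r)) (nhdsWithin (0 : ℝ) (Set.Ioc 0 1))
        (nhds (π (Fz 0))) :=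
      (π.continuous.tendsto _).comp
        ((hF.continuousOn 0 (by simp)).mono_left (nhdsWithin_mono _ Set.Ioc_subset_Icc_self))
    have := (((((tr.const_mul 2).mul t3).mul t2).sub
      ((((t4.sub (tr.mul t5)).const_mul 2)).mul t1)).add
      (((tr.const_mul 2).mul t2).mul t1)).add (t1.pow 2)
    have h0 : (2 * 0 * π 0 * π L1 - 2 * (π (L2 - 0) - 0 * π (Fz 0)) * π 0 + 2 * 0 * π L1 * π 0
      + π 0 ^ 2 : ℝ) = 0 := by simp
    rw [h0] at this
    refine this.congr fun r => ?_
    simp only [hE, Function.comp_apply]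
    ring
  have cEt := hcu E 0 cE tE
  have main := intervalIntegral.integral_le_sub_of_hasDeriv_right_of_le
    (a := 0) (b := 1) (g := Function.update E 0 0)
    (φ := fun r => r * (π (Function.update (Lop ψ) 0 0 r)) ^ 2 - r * (π (Fz r)) ^ 2)
    (g' := fun r => ((2 * π (Lop ψ r) + 2 * r * π (dz (Lop ψ) r)) * π (dz ψ r)
        + 2 * r * π (Lop ψ r) * π (dz (dz ψ) r))
      - ((2 * (π (dz (Lop ψ) r) - π (Fz r)) + 2 * r * (π (dz (dz (Lop ψ)) r) - π (dz Fz r)))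
          * π (ψ r) + 2 * r * (π (dz (Lop ψ) r) - π (Fz r)) * π (dz ψ r))
      + ((2 * π (dz ψ r) + 2 * r * π (dz (dz ψ) r)) * π (ψ r)
        + 2 * r * π (dz ψ r) * π (dz ψ r)) + 2 * π (ψ r) * π (dz ψ r))
    zero_le_one cEt ?_ ?_ ?_
  · refine main.trans (le_of_eq ?_)
    have : Lop ψ 1 = (-α) • dz ψ 1 := by rw [hα, Complex.real_smul]; push_cast; ring
    rw [Function.update_of_ne one_ne_zero, Function.update_self]
    simp only [hE, hb, this, map_smul, map_zero, smul_eq_mul]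
    ring
  · intro r hr
    have h := aux_deriv _ _ _ _ _ r _ _ _ _ _ (hd ψ (hψ.differentiableOn (by norm_num)) r hr)
      (hd _ (c1.differentiableOn (by norm_num)) r hr)
      (hd _ (cw.differentiableOn (by norm_num)) r hr)
      (hd _ (cw1.differentiableOn (by norm_num)) r hr)
      (hd Fz ((hF.differentiableOn (by norm_num)).mono Set.Ioc_subset_Icc_self) r hr)
    refine HasDerivAt.hasDerivWithinAt (h.congr_of_eventuallyEq ?_)
    filter_upwards [isOpen_ne.mem_nhds hr.1.ne'] with x hx
    rw [Function.update_of_ne hx]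
  · apply ContinuousOn.integrableOn_Icc
    have a3 := π.continuous.comp_continuousOn cwt
    have a5 := π.continuous.comp_continuousOn hF.continuousOn
    exact (continuousOn_id.mul (a3.pow 2)).sub (continuousOn_id.mul (a5.pow 2))
  · intro r hr
    simp only [Function.update_of_ne hr.1.ne']
    refine aux_ineq r _ _ _ _ _ _ _ _ hr.1 hr.2 (hL ψ r) ?_
    rw [← hL, heq r hr]

lemma aux_wInt (g : ℝ → ℂ) (hg : ContinuousOn g (Set.Icc 0 1)) :
    wInt (fun r => ‖g r‖ ^ 2 * r) = ENNReal.ofReal (∫ r in (0:ℝ)..1, ‖g r‖ ^ 2 * r) := by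
  have hc : ContinuousOn (fun r => ‖g r‖ ^ 2 * r) (Set.Icc 0 1) :=
    (hg.norm.pow 2).mul continuousOn_id
  rw [intervalIntegral.integral_of_le zero_le_one, integral_Ioc_eq_integral_Ioo,
    ofReal_integral_eq_lintegral_ofReal, wInt]
  · exact hc.integrableOn_Icc.mono_set Set.Ioo_subset_Icc_self
  · filter_upwards [ae_restrict_mem measurableSet_Ioo] with r hr
    exact mul_nonneg (by positivity) hr.1.le

/-- Proposition 3.2, estimate (B-1)/(2-1-7-0): the zero mode of the linearized problem.
There is a constant `C > 0`, independent of `α` and `F^z`, such that every solution `ψ`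
of `𝓛²ψ = (F^z)'` on `(0,1)`, four times continuously differentiable on `(0,1]`, with
`ψ, ψ', 𝓛ψ, (d/dr)(r 𝓛ψ)` extending continuously to `[0,1]`, satisfying
`ψ(0) = ψ(1) = (𝓛ψ)(0) = 0` and `(𝓛ψ)(1) = −α ψ'(1)`, obeys
`∫₀¹ |𝓛ψ|² r dr + α |ψ'(1)|² ≤ C ∫₀¹ |F^z|² r dr`. -/
theorem zero_mode_estimate :
    ∃ C : ℝ, 0 < C ∧ ∀ (α : ℝ) (Fz ψ : ℝ → ℂ),
      0 ≤ α →
      ContDiffOn ℝ 1 Fz (Set.Icc 0 1) →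
      ContDiffOn ℝ 4 ψ (Set.Ioc 0 1) →
      -- `ψ` extends continuously to `[0,1]` with `ψ(0) = 0`
      Filter.Tendsto ψ (nhdsWithin (0 : ℝ) (Set.Ioc 0 1)) (nhds (0 : ℂ)) →
      -- `ψ'` extends continuously to `[0,1]`
      (∃ L : ℂ, Filter.Tendsto (dz ψ) (nhdsWithin (0 : ℝ) (Set.Ioc 0 1)) (nhds L)) →
      -- `𝓛ψ` extends continuously to `[0,1]` with `(𝓛ψ)(0) = 0`
      Filter.Tendsto (Lop ψ) (nhdsWithin (0 : ℝ) (Set.Ioc 0 1)) (nhds (0 : ℂ)) →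
      -- `(d/dr)(r 𝓛ψ)` extends continuously to `[0,1]`
      (∃ L : ℂ, Filter.Tendsto (dz (fun r => (r : ℂ) * Lop ψ r))
          (nhdsWithin (0 : ℝ) (Set.Ioc 0 1)) (nhds L)) →
      -- the equation `𝓛²ψ = (F^z)'` on `(0,1)`
      (∀ r ∈ Set.Ioo (0 : ℝ) 1, Lop (Lop ψ) r = dz Fz r) →
      ψ 1 = 0 →
      Lop ψ 1 = -(α : ℂ) * dz ψ 1 →
      wInt (fun r => ‖Lop ψ r‖ ^ 2 * r) + ENNReal.ofReal (α * ‖dz ψ 1‖ ^ 2)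
        ≤ ENNReal.ofReal C * wInt (fun r => ‖Fz r‖ ^ 2 * r) := by
  refine ⟨1, one_pos, ?_⟩
  intro α Fz ψ hα0 hF hψ h1 h2 h3 h4 heq hb hα
  obtain ⟨cw, hre⟩ := aux_comp Complex.reCLM α Fz ψ hF hψ h1 h2 h3 h4 heq hb hα
  obtain ⟨-, him⟩ := aux_comp Complex.imCLM α Fz ψ hF hψ h1 h2 h3 h4 heq hb hα
  have e1 : wInt (fun r => ‖Lop ψ r‖ ^ 2 * r)
      = wInt (fun r => ‖Function.update (Lop ψ) 0 0 r‖ ^ 2 * r) := by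
    unfold wInt
    refine setLIntegral_congr_fun measurableSet_Ioo fun r hr => ?_
    simp only [Function.update_of_ne hr.1.ne']
  set W := Function.update (Lop ψ) 0 0 with hW
  rw [e1, aux_wInt W cw, aux_wInt Fz hF.continuousOn, ENNReal.ofReal_one, one_mul,
    ← ENNReal.ofReal_add _ (by positivity)]
  swap
  · exact intervalIntegral.integral_nonneg zero_le_one
      fun r hr => mul_nonneg (by positivity) hr.1
  apply ENNReal.ofReal_le_ofReal
  have ii : ∀ (π : ℂ →L[ℝ] ℝ), IntervalIntegrable
      (fun r => r * (π (W r)) ^ 2 - r * (π (Fz r)) ^ 2) volume 0 1 := by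
    intro π
    apply ContinuousOn.intervalIntegrable_of_Icc zero_le_one
    have a3 := π.continuous.comp_continuousOn cw
    have a5 := π.continuous.comp_continuousOn hF.continuousOn
    exact (continuousOn_id.mul (a3.pow 2)).sub (continuousOn_id.mul (a5.pow 2))
  have jj : ∀ g : ℝ → ℂ, ContinuousOn g (Set.Icc 0 1) →
      IntervalIntegrable (fun r => ‖g r‖ ^ 2 * r) volume 0 1 := by
    intro g hg
    apply ContinuousOn.intervalIntegrable_of_Icc zero_le_one
    exact (hg.norm.pow 2).mul continuousOn_id
  have hn : ∀ z : ℂ, ‖z‖ ^ 2 = z.re ^ 2 + z.im ^ 2 := by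
    intro z
    rw [← Complex.normSq_eq_norm_sq, Complex.normSq_apply]; ring
  have hsum := add_le_add hre him
  rw [← intervalIntegral.integral_add (ii _) (ii _)] at hsum
  have e2 : ∫ r in (0:ℝ)..1, ((r * (Complex.reCLM (W r)) ^ 2 - r * (Complex.reCLM (Fz r)) ^ 2)
      + (r * (Complex.imCLM (W r)) ^ 2 - r * (Complex.imCLM (Fz r)) ^ 2))
      = (∫ r in (0:ℝ)..1, ‖W r‖ ^ 2 * r) - ∫ r in (0:ℝ)..1, ‖Fz r‖ ^ 2 * r := by
    rw [← intervalIntegral.integral_sub (jj W cw) (jj Fz hF.continuousOn)]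
    congr 1
    funext r
    simp only [hn, Complex.reCLM_apply, Complex.imCLM_apply]
    ring
  rw [e2] at hsum
  have e3 : - 2 * α * (Complex.reCLM (dz ψ 1)) ^ 2 + - 2 * α * (Complex.imCLM (dz ψ 1)) ^ 2
      = - 2 * (α * ‖dz ψ 1‖ ^ 2) := by
    simp only [hn, Complex.reCLM_apply, Complex.imCLM_apply]
    ring
  rw [e3] at hsum
  have : 0 ≤ α * ‖dz ψ 1‖ ^ 2 := by positivity
  linarith
end

section
/- There exists a constant C > 0 such that for every nonzero real number ξ the following four estimates hold: (i) ∫₀¹ I₁(|ξ|·r)²·r dr ≤ C·min{1, |ξ|⁻¹}·I₁(|ξ|)²; (ii) ∫₀¹ ((d/dr)(r·I₁(|ξ|·r)))²·(1/r) dr ≤ C·max{1, |ξ|}·I₁(|ξ|)²; (iii) ∫₀¹ ((𝓛h)(r))²·r dr ≤ C·min{1, |ξ|⁻¹}·ξ⁴·I₁(|ξ|)², where h(r) = I₁(|ξ|·r); (iv) ∫₀¹ ((d/dr)(r·(𝓛h)(r)))²·(1/r) dr ≤ C·max{1, |ξ|}·ξ⁴·I₁(|ξ|)². (Lemma A.7,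 integral estimates for the modified Bessel function of the first kind.) -/
open MeasureTheory

/-- The modified Bessel function of the first kind of order one,
`I₁(x) = Σ_{k=0}^∞ (1/(k! (k+1)!)) (x/2)^{2k+1}`. -/
noncomputable def besselI1 (x : ℝ) : ℝ :=
  ∑' k : ℕ, 1 / ((Nat.factorial k : ℝ) * (Nat.factorial (k + 1) : ℝ)) * (x / 2) ^ (2 * k + 1)

/-- The operator `(𝓛 g)(r) = g''(r) + (1/r) g'(r) − (1/r²) g(r)` for real-valued `g`. -/
noncomputable def LopR (g : ℝ → ℝ) : ℝ → ℝ := fun r =>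
  deriv (deriv g) r + (1 / r) * deriv g r - (1 / r ^ 2) * g r

/-- Power series with coefficients `c`. -/
noncomputable def psum (c : ℕ → ℝ) (y : ℝ) : ℝ := ∑' k : ℕ, c k * y ^ k

lemma psum_summable {c : ℕ → ℝ} (hc : ∀ k, |c k| ≤ 1 / (Nat.factorial k : ℝ)) (y : ℝ) :
    Summable (fun k => c k * y ^ k) := by
  refine Summable.of_norm_bounded (g := fun k => |y| ^ k / (Nat.factorial k : ℝ))
    (Real.summable_pow_div_factorial |y|) ?_
  intro k
  rw [Real.norm_eq_abs, abs_mul, abs_pow]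
  calc |c k| * |y| ^ k ≤ 1 / (Nat.factorial k : ℝ) * |y| ^ k := by
        gcongr; exact hc k
    _ = _ := by ring

lemma psum_hasDerivAt {c d : ℕ → ℝ} (hc : ∀ k, |c k| ≤ 1 / (Nat.factorial k : ℝ))
    (hd : ∀ k : ℕ, ((k : ℝ) + 1) * c (k + 1) = d k) (y : ℝ) :
    HasDerivAt (psum c) (psum d y) y := by
  set R : ℝ := |y| + 1 with hR
  have hRpos : 0 < R := by positivity
  have hsum : Summable (fun k : ℕ => (k : ℝ) / (Nat.factorial k : ℝ) * R ^ (k - 1)) := by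
    rw [← summable_nat_add_iff 1]
    refine (Real.summable_pow_div_factorial R).congr ?_
    intro k
    rw [Nat.factorial_succ]
    have : (Nat.factorial k : ℝ) ≠ 0 := by positivity
    have h2 : (k : ℝ) + 1 ≠ 0 := by positivity
    push_cast
    field_simp
  have key := hasDerivAt_tsum_of_isPreconnected (𝕜 := ℝ) (t := Metric.ball (0 : ℝ) R)
    (g := fun k z => c k * z ^ k) (g' := fun k z => c k * ((k : ℝ) * z ^ (k - 1)))
    (y₀ := 0) (y := y) hsum Metric.isOpen_ball (convex_ball _ _).isPreconnected
    (fun k z _ => (hasDerivAt_pow k z).const_mul (c k))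
    (by
      intro k z hz
      have hz' : |z| ≤ R := by
        have := mem_ball_zero_iff.1 hz
        rw [Real.norm_eq_abs] at this
        exact this.le
      rw [Real.norm_eq_abs, abs_mul, abs_mul, abs_pow, Nat.abs_cast]
      calc |c k| * ((k : ℝ) * |z| ^ (k - 1))
          ≤ 1 / (Nat.factorial k : ℝ) * ((k : ℝ) * R ^ (k - 1)) := by
            gcongr; exact hc k
        _ = _ := by ring)
    (Metric.mem_ball_self hRpos) (psum_summable hc 0)
    (by rw [mem_ball_zero_iff, Real.norm_eq_abs]; linarith)
  have hy : |y| ≤ R := by linarith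
  have hS : Summable (fun k : ℕ => c k * ((k : ℝ) * y ^ (k - 1))) := by
    refine Summable.of_norm_bounded hsum ?_
    intro k
    rw [Real.norm_eq_abs, abs_mul, abs_mul, abs_pow, Nat.abs_cast]
    calc |c k| * ((k : ℝ) * |y| ^ (k - 1))
          ≤ 1 / (Nat.factorial k : ℝ) * ((k : ℝ) * R ^ (k - 1)) := by
            gcongr; exact hc k
        _ = _ := by ring
  have e : ∑' k : ℕ, c k * ((k : ℝ) * y ^ (k - 1)) = psum d y := by
    rw [hS.tsum_eq_zero_add]
    simp only [Nat.cast_zero, zero_mul, mul_zero, zero_add, psum]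
    refine tsum_congr fun k => ?_
    rw [← hd k]
    push_cast
    ring
  rw [e] at key
  exact key

/-- Coefficients. -/
noncomputable def cF (k : ℕ) : ℝ := 1 / ((Nat.factorial k : ℝ) * (Nat.factorial (k + 1) : ℝ))
/-- Coefficients. -/
noncomputable def cG (k : ℕ) : ℝ := 1 / ((Nat.factorial k : ℝ) * (Nat.factorial k : ℝ))
/-- Coefficients. -/
noncomputable def cH (k : ℕ) : ℝ := (k : ℝ) / ((Nat.factorial k : ℝ) * (Nat.factorial k : ℝ))

lemma one_le_fac (k : ℕ) : (1 : ℝ) ≤ (Nat.factorial k : ℝ) := by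
  exact_mod_cast Nat.one_le_iff_ne_zero.2 (Nat.factorial_ne_zero k)

lemma cF_nonneg (k : ℕ) : 0 ≤ cF k := by unfold cF; positivity
lemma cG_nonneg (k : ℕ) : 0 ≤ cG k := by unfold cG; positivity
lemma cH_nonneg (k : ℕ) : 0 ≤ cH k := by unfold cH; positivity

lemma cF_le (k : ℕ) : |cF k| ≤ 1 / (Nat.factorial k : ℝ) := by
  rw [abs_of_nonneg (cF_nonneg k)]
  unfold cF
  have h1 := one_le_fac k
  have h2 := one_le_fac (k + 1)
  apply one_div_le_one_div_of_le (by linarith)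
  nlinarith

lemma cG_le (k : ℕ) : |cG k| ≤ 1 / (Nat.factorial k : ℝ) := by
  rw [abs_of_nonneg (cG_nonneg k)]
  unfold cG
  have h1 := one_le_fac k
  apply one_div_le_one_div_of_le (by linarith)
  nlinarith

lemma cH_le (k : ℕ) : |cH k| ≤ 1 / (Nat.factorial k : ℝ) := by
  rw [abs_of_nonneg (cH_nonneg k)]
  unfold cH
  have h1 := one_le_fac k
  have h2 : (k : ℝ) ≤ (Nat.factorial k : ℝ) := by exact_mod_cast Nat.self_le_factorial k
  rw [div_le_div_iff₀ (by positivity) (by positivity)]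
  nlinarith

lemma G_deriv (y : ℝ) : HasDerivAt (psum cG) (psum cF y) y := by
  refine psum_hasDerivAt cG_le (fun k => ?_) y
  unfold cG cF
  rw [Nat.factorial_succ]
  have : (Nat.factorial k : ℝ) ≠ 0 := by positivity
  have h2 : (k : ℝ) + 1 ≠ 0 := by positivity
  push_cast
  field_simp

lemma H_deriv (y : ℝ) : HasDerivAt (psum cH) (psum cG y) y := by
  refine psum_hasDerivAt cH_le (fun k => ?_) y
  unfold cG cH
  rw [Nat.factorial_succ]
  have : (Nat.factorial k : ℝ) ≠ 0 := by positivity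
  have h2 : (k : ℝ) + 1 ≠ 0 := by positivity
  push_cast
  field_simp

lemma H_eq (y : ℝ) : psum cH y = y * psum cF y := by
  unfold psum
  rw [(psum_summable cH_le y).tsum_eq_zero_add, ← tsum_mul_left]
  simp only [cH, Nat.cast_zero, zero_div, zero_mul, zero_add]
  refine tsum_congr fun k => ?_
  unfold cF
  rw [Nat.factorial_succ]
  have : (Nat.factorial k : ℝ) ≠ 0 := by positivity
  have h2 : (k : ℝ) + 1 ≠ 0 := by positivity
  push_cast
  field_simp
  ring

lemma I1_eq (x : ℝ) : besselI1 x = x / 2 * psum cF (x ^ 2 / 4) := by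
  unfold besselI1 psum
  rw [← tsum_mul_left]
  refine tsum_congr fun k => ?_
  unfold cF
  have : x ^ 2 / 4 = (x / 2) ^ 2 := by ring
  rw [this, ← pow_mul]
  ring

/-- The modified Bessel function of order zero. -/
noncomputable def bI0 (x : ℝ) : ℝ := psum cG (x ^ 2 / 4)

lemma bI0_nonneg (x : ℝ) : 0 ≤ bI0 x :=
  tsum_nonneg fun k => mul_nonneg (cG_nonneg k) (by positivity)

lemma F_nonneg (x : ℝ) : 0 ≤ psum cF (x ^ 2 / 4) :=
  tsum_nonneg fun k => mul_nonneg (cF_nonneg k) (by positivity)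

lemma I1_nonneg {x : ℝ} (hx : 0 ≤ x) : 0 ≤ besselI1 x := by
  rw [I1_eq]
  have := F_nonneg x
  positivity

lemma sq4_deriv (x : ℝ) : HasDerivAt (fun x : ℝ => x ^ 2 / 4) (x / 2) x := by
  have := (hasDerivAt_pow 2 x).div_const 4
  refine HasDerivAt.congr_deriv this ?_
  norm_num
  ring

lemma bI0_deriv (x : ℝ) : HasDerivAt bI0 (besselI1 x) x := by
  have := (G_deriv (x ^ 2 / 4)).comp x (sq4_deriv x)
  rw [I1_eq, mul_comm]
  exact this

/-- `x I₁(x)` -/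
noncomputable def bu (x : ℝ) : ℝ := x * besselI1 x

lemma bu_deriv (x : ℝ) : HasDerivAt bu (x * bI0 x) x := by
  have := ((H_deriv (x ^ 2 / 4)).comp x (sq4_deriv x)).const_mul 2
  have e : bu = fun x => 2 * (psum cH ∘ fun x : ℝ => x ^ 2 / 4) x := by
    funext z
    simp only [bu, Function.comp, H_eq, I1_eq]
    ring
  rw [e]
  refine HasDerivAt.congr_deriv this ?_
  unfold bI0
  ring

lemma I1_deriv {x : ℝ} (hx : 0 < x) :
    HasDerivAt besselI1 (bI0 x - besselI1 x / x) x := by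
  have h := (bu_deriv x).div (hasDerivAt_id x) hx.ne'
  have e : besselI1 =ᶠ[nhds x] (bu / id) := by
    filter_upwards [lt_mem_nhds hx] with z hz
    simp only [Pi.div_apply, bu, id]
    field_simp
  refine (h.congr_of_eventuallyEq e).congr_deriv ?_
  simp only [id, bu]
  field_simp

lemma nonneg_of_deriv {f f' : ℝ → ℝ} (h : ∀ x, HasDerivAt f (f' x) x)
    (h' : ∀ x, 0 < x → 0 ≤ f' x) (h0 : f 0 = 0) {x : ℝ} (hx : 0 ≤ x) : 0 ≤ f x := by
  have hm : MonotoneOn f (Set.Ici 0) := by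
    refine monotoneOn_of_deriv_nonneg (convex_Ici 0)
      (fun z _ => (h z).continuousAt.continuousWithinAt)
      (fun z _ => (h z).differentiableAt.differentiableWithinAt) ?_
    intro z hz
    rw [interior_Ici] at hz
    rw [(h z).deriv]
    exact h' z hz
  rw [← h0]
  exact hm Set.self_mem_Ici hx hx

lemma I1_le_I0 {x : ℝ} (hx : 0 < x) : besselI1 x ≤ bI0 x := by
  have key : 0 ≤ Real.exp x * (x * bI0 x - bu x) := by
    refine nonneg_of_deriv (f := fun x => Real.exp x * (x * bI0 x - bu x))
      (f' := fun x => Real.exp x * bI0 x) (fun z => ?_)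
      (fun z _ => mul_nonneg (Real.exp_pos z).le (bI0_nonneg z)) (by simp [bu]) hx.le
    have := (Real.hasDerivAt_exp z).mul (((hasDerivAt_id z).mul (bI0_deriv z)).sub (bu_deriv z))
    refine HasDerivAt.congr_deriv this ?_
    simp [bu]
    ring
  have := nonneg_of_mul_nonneg_right key (Real.exp_pos x)
  unfold bu at this
  nlinarith

lemma I0_lower {x : ℝ} (hx : 0 < x) : 2 * besselI1 x ≤ x * bI0 x := by
  have key : 0 ≤ x ^ 2 * bI0 x - 2 * bu x := by
    refine nonneg_of_deriv (f := fun x => x ^ 2 * bI0 x - 2 * bu x)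
      (f' := fun x => x ^ 2 * besselI1 x) (fun z => ?_)
      (fun z hz => mul_nonneg (by positivity) (I1_nonneg hz.le)) (by simp [bu]) hx.le
    have := ((hasDerivAt_pow 2 z).mul (bI0_deriv z)).sub ((bu_deriv z).const_mul 2)
    refine HasDerivAt.congr_deriv this ?_
    norm_num
    ring
  unfold bu at key
  nlinarith

lemma I0_upper {x : ℝ} (hx : 0 < x) : x * bI0 x ≤ (x + 2) * besselI1 x := by
  have key : 0 ≤ Real.exp x * ((x + 2) * bu x - x ^ 2 * bI0 x) := by
    refine nonneg_of_deriv (f := fun x => Real.exp x * ((x + 2) * bu x - x ^ 2 * bI0 x))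
      (f' := fun x => Real.exp x * (3 * bu x)) (fun z => ?_)
      (fun z hz => ?_) (by simp [bu]) hx.le
    · have := (Real.hasDerivAt_exp z).mul ((((hasDerivAt_id z).add_const 2).mul (bu_deriv z)).sub
        ((hasDerivAt_pow 2 z).mul (bI0_deriv z)))
      refine HasDerivAt.congr_deriv this ?_
      simp [bu]
      ring
    · have := I1_nonneg hz.le
      unfold bu
      positivity
  have := nonneg_of_mul_nonneg_right key (Real.exp_pos x)
  unfold bu at this
  nlinarith

lemma I1_decay {x y : ℝ} (hx : 0 < x) (hxy : x ≤ y) :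
    besselI1 x ≤ Real.exp (-(y - x) / 2) * besselI1 y := by
  have hd : ∀ z : ℝ, 0 < z → HasDerivAt (fun z => Real.exp (-z / 2) * besselI1 z)
      (Real.exp (-z / 2) * (bI0 z - besselI1 z / z - besselI1 z / 2)) z := by
    intro z hz
    have h1 : HasDerivAt (fun z : ℝ => -z / 2) (-1 / 2) z := (hasDerivAt_id z).neg.div_const 2
    have := h1.exp.mul (I1_deriv hz)
    refine HasDerivAt.congr_deriv this ?_
    ring
  have hm : MonotoneOn (fun z => Real.exp (-z / 2) * besselI1 z) (Set.Ioi 0) := by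
    refine monotoneOn_of_deriv_nonneg (convex_Ioi 0)
      (fun z hz => (hd z hz).continuousAt.continuousWithinAt)
      (fun z hz => (hd z (interior_subset hz)).differentiableAt.differentiableWithinAt) ?_
    intro z hz
    have hz : 0 < z := interior_subset hz
    rw [(hd z hz).deriv]
    refine mul_nonneg (Real.exp_pos _).le ?_
    have a1 := I1_le_I0 hz
    have a2 := I0_lower hz
    have a3 := I1_nonneg hz.le
    have : bI0 z - besselI1 z / z - besselI1 z / 2
        = (z * bI0 z - besselI1 z - z * besselI1 z / 2) / z := by field_simp
    rw [this]
    refine div_nonneg ?_ hz.le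
    rcases le_total z 2 with h | h
    · nlinarith
    · nlinarith
  have h := hm (Set.mem_Ioi.2 hx) (Set.mem_Ioi.2 (hx.trans_le hxy)) hxy
  have e : Real.exp (-(y - x) / 2) = Real.exp (x / 2) * Real.exp (-y / 2) := by
    rw [← Real.exp_add]; congr 1; ring
  have e2 : Real.exp (x / 2) * Real.exp (-x / 2) = 1 := by
    rw [← Real.exp_add, ← Real.exp_zero]; congr 1; ring
  rw [e]
  have h3 := mul_le_mul_of_nonneg_left h (Real.exp_pos (x / 2)).le
  simp only at h3
  rw [← mul_assoc, e2, one_mul] at h3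
  linarith

lemma I1_scale {a r : ℝ} (ha : 0 < a) (hr : 0 < r) (hr1 : r ≤ 1) :
    besselI1 (a * r) ≤ r * besselI1 a := by
  rw [I1_eq, I1_eq]
  have : psum cF ((a * r) ^ 2 / 4) ≤ psum cF (a ^ 2 / 4) := by
    refine Summable.tsum_le_tsum (fun k => ?_) (psum_summable cF_le _) (psum_summable cF_le _)
    have := cF_nonneg k
    have h2 : a * r ≤ a := by nlinarith
    gcongr
  calc a * r / 2 * psum cF ((a * r) ^ 2 / 4) ≤ a * r / 2 * psum cF (a ^ 2 / 4) := by gcongr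
    _ = _ := by ring

lemma exp_int {a : ℝ} (ha : 0 < a) :
    ∫ r in (0 : ℝ)..1, Real.exp (-(a * (1 - r)) / 2) ≤ 2 * min 1 a⁻¹ := by
  have hd : ∀ r : ℝ, HasDerivAt (fun r => 2 / a * Real.exp (-(a * (1 - r)) / 2))
      (Real.exp (-(a * (1 - r)) / 2)) r := by
    intro r
    have h1 : HasDerivAt (fun r : ℝ => -(a * (1 - r)) / 2) (a / 2) r := by
      have := ((((hasDerivAt_id r).const_sub 1).const_mul a).neg).div_const 2
      refine HasDerivAt.congr_deriv this ?_
      ring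
    have := h1.exp.const_mul (2 / a)
    refine HasDerivAt.congr_deriv this ?_
    field_simp
  have hc : Continuous (fun r : ℝ => Real.exp (-(a * (1 - r)) / 2)) := by fun_prop
  rw [mul_min_of_nonneg _ _ (by norm_num : (0 : ℝ) ≤ 2), le_min_iff]
  constructor
  · have : ∫ r in (0 : ℝ)..1, Real.exp (-(a * (1 - r)) / 2) ≤ ∫ r in (0 : ℝ)..1, (1 : ℝ) := by
      refine intervalIntegral.integral_mono_on (by norm_num) (hc.intervalIntegrable _ _)
        (continuous_const.intervalIntegrable _ _) (fun r hr => ?_)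
      rw [Real.exp_le_one_iff]
      have : 0 ≤ a * (1 - r) := mul_nonneg ha.le (by linarith [hr.2])
      linarith
    refine this.trans ?_
    simp
  · rw [intervalIntegral.integral_eq_sub_of_hasDerivAt (fun r _ => hd r)
      (hc.intervalIntegrable _ _)]
    have := Real.exp_pos (-(a * (1 - 0)) / 2)
    have h2 : 0 < 2 / a * Real.exp (-(a * (1 - 0)) / 2) := by positivity
    simp only [sub_self, mul_zero, neg_zero, zero_div, Real.exp_zero, mul_one] at *
    rw [← div_eq_mul_inv]
    linarith

lemma wInt_bound {a K M : ℝ} (ha : 0 < a) (hK : 0 ≤ K) {h : ℝ → ℝ}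
    (hb : ∀ r, 0 < r → r < 1 → h r ≤ K * Real.exp (-(a * (1 - r)) / 2))
    (hM : K * (2 * min 1 a⁻¹) ≤ M) :
    wInt h ≤ ENNReal.ofReal M := by
  have hc : Continuous (fun r : ℝ => K * Real.exp (-(a * (1 - r)) / 2)) := by fun_prop
  have h1 : wInt h ≤ ∫⁻ r in Set.Ioo (0 : ℝ) 1,
      ENNReal.ofReal (K * Real.exp (-(a * (1 - r)) / 2)) := by
    unfold wInt
    refine setLIntegral_mono' measurableSet_Ioo (fun r hr => ?_)
    exact ENNReal.ofReal_le_ofReal (hb r hr.1 hr.2)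
  refine h1.trans ?_
  have hi : Integrable (fun r : ℝ => K * Real.exp (-(a * (1 - r)) / 2))
      (volume.restrict (Set.Ioo (0 : ℝ) 1)) :=
    (hc.integrableOn_Icc (a := 0) (b := 1)).mono_set Set.Ioo_subset_Icc_self
  rw [← ofReal_integral_eq_lintegral_ofReal hi
    (Filter.Eventually.of_forall fun r => by positivity)]
  refine ENNReal.ofReal_le_ofReal ?_
  rw [← integral_Ioc_eq_integral_Ioo, ← intervalIntegral.integral_of_le (by norm_num),
    intervalIntegral.integral_const_mul]
  exact (mul_le_mul_of_nonneg_left (exp_int ha) hK).trans hM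

lemma pt_one {a r : ℝ} (ha : 0 < a) (hr : 0 < r) (hr1 : r < 1) :
    (besselI1 (a * r)) ^ 2 * r ≤ besselI1 a ^ 2 * Real.exp (-(a * (1 - r)) / 2) := by
  have h1 := I1_scale ha hr hr1.le
  have h2 := I1_decay (mul_pos ha hr) (by nlinarith : a * r ≤ a)
  have e : a - a * r = a * (1 - r) := by ring
  rw [e] at h2
  have h3 := I1_nonneg (mul_pos ha hr).le
  have h4 := I1_nonneg ha.le
  have h5 : besselI1 (a * r) ≤ besselI1 a := by nlinarith
  calc (besselI1 (a * r)) ^ 2 * r ≤ (besselI1 (a * r)) ^ 2 * 1 := by gcongr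
    _ = besselI1 (a * r) * besselI1 (a * r) := by ring
    _ ≤ (Real.exp (-(a * (1 - r)) / 2) * besselI1 a) * besselI1 a := by gcongr
    _ = _ := by ring

lemma pt_two {a r : ℝ} (ha : 0 < a) (hr : 0 < r) (hr1 : r < 1) :
    (a * r * bI0 (a * r)) ^ 2 / r
      ≤ ((2 + a) ^ 2 * besselI1 a ^ 2) * Real.exp (-(a * (1 - r)) / 2) := by
  have h0 := I0_upper (mul_pos ha hr)
  have h1 := I1_scale ha hr hr1.le
  have h2 := I1_decay (mul_pos ha hr) (by nlinarith : a * r ≤ a)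
  have e : a - a * r = a * (1 - r) := by ring
  rw [e] at h2
  have h3 := I1_nonneg (mul_pos ha hr).le
  have h4 := I1_nonneg ha.le
  have h5 : a * r ≤ a := by nlinarith
  have h6 := bI0_nonneg (a * r)
  rw [div_le_iff₀ hr]
  calc (a * r * bI0 (a * r)) ^ 2 ≤ ((a + 2) * besselI1 (a * r)) ^ 2 := by
        refine pow_le_pow_left₀ (by positivity) (h0.trans ?_) 2
        gcongr
    _ = (a + 2) ^ 2 * (besselI1 (a * r) * besselI1 (a * r)) := by ring
    _ ≤ (a + 2) ^ 2 * ((Real.exp (-(a * (1 - r)) / 2) * besselI1 a) * (r * besselI1 a)) := by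
        gcongr
    _ = _ := by ring

lemma deriv_two {a r : ℝ} (ha : 0 < a) :
    HasDerivAt (fun s => s * besselI1 (a * s)) (a * r * bI0 (a * r)) r := by
  have h1 : HasDerivAt (fun s : ℝ => a * s) a r := by
    simpa using (hasDerivAt_id r).const_mul a
  have := ((bu_deriv (a * r)).comp r h1).div_const a
  have e : (fun s => s * besselI1 (a * s)) = fun s => (bu ∘ fun s => a * s) s / a := by
    funext s
    simp only [bu, Function.comp]
    field_simp
  rw [e]
  refine HasDerivAt.congr_deriv this ?_
  field_simp

lemma Lop_eq {a r : ℝ} (ha : 0 < a) (hr : 0 < r) :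
    LopR (fun s => besselI1 (a * s)) r = a ^ 2 * besselI1 (a * r) := by
  have hl : ∀ s : ℝ, HasDerivAt (fun s : ℝ => a * s) a s := fun s => by
    simpa using (hasDerivAt_id s).const_mul a
  have h1 : ∀ s : ℝ, 0 < s → HasDerivAt (fun s => besselI1 (a * s))
      ((bI0 (a * s) - besselI1 (a * s) / (a * s)) * a) s := fun s hs =>
    (I1_deriv (mul_pos ha hs)).comp s (hl s)
  have har := mul_pos ha hr
  have h2 : HasDerivAt (fun s => (bI0 (a * s) - besselI1 (a * s) / (a * s)) * a)
      ((besselI1 (a * r) * a - (((bI0 (a * r) - besselI1 (a * r) / (a * r)) * a) * (a * r)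
        - besselI1 (a * r) * a) / (a * r) ^ 2) * a) r :=
    (((bI0_deriv (a * r)).comp r (hl r)).sub ((h1 r hr).div (hl r) har.ne')).mul_const a
  have ee : deriv (fun s => besselI1 (a * s)) =ᶠ[nhds r]
      fun s => (bI0 (a * s) - besselI1 (a * s) / (a * s)) * a := by
    filter_upwards [lt_mem_nhds hr] with s hs
    exact (h1 s hs).deriv
  unfold LopR
  rw [ee.deriv_eq, h2.deriv, (h1 r hr).deriv]
  field_simp
  ring

lemma deriv_four {a r : ℝ} (ha : 0 < a) (hr : 0 < r) :
    deriv (fun s => s * LopR (fun t => besselI1 (a * t)) s) r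
      = a ^ 2 * (a * r * bI0 (a * r)) := by
  have ee : (fun s => s * LopR (fun t => besselI1 (a * t)) s) =ᶠ[nhds r]
      fun s => a ^ 2 * (s * besselI1 (a * s)) := by
    filter_upwards [lt_mem_nhds hr] with s hs
    rw [Lop_eq ha hs]
    ring
  rw [ee.deriv_eq]
  exact ((deriv_two ha).const_mul (a ^ 2)).deriv

lemma max_bound {a : ℝ} (ha : 0 < a) : (2 + a) ^ 2 * (2 * min 1 a⁻¹) ≤ 18 * max 1 a := by
  rcases le_total a 1 with h | h
  · have h1 : min 1 a⁻¹ ≤ 1 := min_le_left _ _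
    have h2 : 1 ≤ max 1 a := le_max_left _ _
    have h3 : (2 + a) ^ 2 ≤ 9 := by nlinarith
    nlinarith [sq_nonneg (2 + a)]
  · have h1 : min 1 a⁻¹ ≤ a⁻¹ := min_le_right _ _
    have h2 : a ≤ max 1 a := le_max_right _ _
    have h3 : (2 + a) ^ 2 ≤ 9 * a ^ 2 := by nlinarith
    calc (2 + a) ^ 2 * (2 * min 1 a⁻¹) ≤ 9 * a ^ 2 * (2 * a⁻¹) := by gcongr
      _ = 18 * a := by field_simp; ring
      _ ≤ _ := by linarith

/-- Lemma A.7, integral estimates for the modified Bessel function of the first kind. -/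
theorem besselI1_integral_estimates :
    ∃ C : ℝ, 0 < C ∧ ∀ ξ : ℝ, ξ ≠ 0 →
      wInt (fun r => (besselI1 (|ξ| * r)) ^ 2 * r)
          ≤ ENNReal.ofReal (C * min 1 |ξ|⁻¹ * (besselI1 |ξ|) ^ 2) ∧
      wInt (fun r => (deriv (fun s => s * besselI1 (|ξ| * s)) r) ^ 2 / r)
          ≤ ENNReal.ofReal (C * max 1 |ξ| * (besselI1 |ξ|) ^ 2) ∧
      wInt (fun r => (LopR (fun s => besselI1 (|ξ| * s)) r) ^ 2 * r)
          ≤ ENNReal.ofReal (C * min 1 |ξ|⁻¹ * ξ ^ 4 * (besselI1 |ξ|) ^ 2) ∧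
      wInt (fun r => (deriv (fun s => s * LopR (fun t => besselI1 (|ξ| * t)) s) r) ^ 2 / r)
          ≤ ENNReal.ofReal (C * max 1 |ξ| * ξ ^ 4 * (besselI1 |ξ|) ^ 2) := by
  refine ⟨18, by norm_num, fun ξ hξ => ?_⟩
  have h4 : ξ ^ 4 = |ξ| ^ 4 := by
    rw [← abs_pow, abs_of_nonneg (by positivity)]
  rw [h4]
  have ha : 0 < |ξ| := abs_pos.2 hξ
  generalize |ξ| = a at ha
  have hm : 0 < min 1 a⁻¹ := lt_min one_pos (inv_pos.2 ha)
  have hB := sq_nonneg (besselI1 a)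
  have hmB := mul_nonneg hm.le hB
  have hmax := mul_le_mul_of_nonneg_right (max_bound ha) hB
  refine ⟨?_, ?_, ?_, ?_⟩
  · refine wInt_bound ha hB (fun r hr hr1 => pt_one ha hr hr1) ?_
    nlinarith
  · refine wInt_bound (K := (2 + a) ^ 2 * besselI1 a ^ 2) ha (by positivity)
      (fun r hr hr1 => ?_) ?_
    · rw [(deriv_two ha).deriv]
      exact pt_two ha hr hr1
    · linarith
  · refine wInt_bound (K := a ^ 4 * besselI1 a ^ 2) ha (by positivity)
      (fun r hr hr1 => ?_) ?_
    · rw [Lop_eq ha hr]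
      have := mul_le_mul_of_nonneg_left (pt_one ha hr hr1) (by positivity : 0 ≤ a ^ 4)
      linarith
    · have : 0 ≤ a ^ 4 * (min 1 a⁻¹ * besselI1 a ^ 2) := by positivity
      linarith
  · refine wInt_bound (K := a ^ 4 * ((2 + a) ^ 2 * besselI1 a ^ 2)) ha (by positivity)
      (fun r hr hr1 => ?_) ?_
    · rw [deriv_four ha hr]
      have := mul_le_mul_of_nonneg_left (pt_two ha hr hr1) (by positivity : 0 ≤ a ^ 4)
      calc (a ^ 2 * (a * r * bI0 (a * r))) ^ 2 / r
          = a ^ 4 * ((a * r * bI0 (a * r)) ^ 2 / r) := by ring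
        _ ≤ _ := this
        _ = _ := by ring
    · have := mul_le_mul_of_nonneg_left hmax (by positivity : 0 ≤ a ^ 4)
      linarith
end
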